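/- Fix s ∈ (0,1) and t ∈ (0, 2−s). For every ε > 0 there is τ > 0 such that: for any piecewise affine 2-Lipschitz function f : [0,m] → ℝ with f(0) = 0 satisfying f(x) ≥ tx − εm for all x ∈ [0,m] and f(m) ≤ (t+ε)m, there exists a family of non-overlapping intervals {[c_j,d_j]} ⊂ [0,m] such that: (i) for each j, either f is ε-linear on [c_j,d_j] with secant slope s_f(c_j,d_j) ≤ 2−s, or f is ε-superlinear on [c_j,d_j] with s_f(c_j,d_j) = 2−s; (ii) d_j − c_j ≥ τm for all j; (iii) the total length of [0,m] not covered by the intervals is ≲_{s,t} εm. -/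

import Mathlib

def PiecewiseAffineOn (f : ℝ → ℝ) (a b : ℝ) : Prop :=
  ∃ (n : ℕ) (t : ℕ → ℝ), t 0 = a ∧ t n = b ∧ (∀ i < n, t i < t (i + 1)) ∧
    ∀ i < n, ∃ p q : ℝ, ∀ x ∈ Set.Icc (t i) (t (i + 1)), f x = p * x + q

/-- The two alternatives for an interval, in terms of `g x = f x - (2 - s) x`. -/
def GoodIv (g : ℝ → ℝ) (ε c e : ℝ) : Prop :=
  ((∀ x ∈ Set.Icc c e, |g x - (g c + (g e - g c) / (e - c) * (x - c))| ≤ ε * (e - c)) ∧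
    g e ≤ g c) ∨
  ((∀ x ∈ Set.Icc c e, g c - ε * (e - c) ≤ g x) ∧ g e = g c)

/-- Ordered families of good intervals inside `[c,d]`. -/
def Fam (g : ℝ → ℝ) (ε τ c d : ℝ) (l : List (ℝ × ℝ)) : Prop :=
  (∀ p ∈ l, c ≤ p.1 ∧ p.1 < p.2 ∧ p.2 ≤ d ∧ GoodIv g ε p.1 p.2 ∧ τ ≤ p.2 - p.1) ∧
  l.Pairwise (fun p q => p.2 ≤ q.1)

def tot (l : List (ℝ × ℝ)) : ℝ := (l.map (fun p => p.2 - p.1)).sum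

def Contact (g : ℝ → ℝ) (x : ℝ) : Prop := ∀ y ∈ Set.Icc 0 x, g x ≤ g y

lemma Fam.append {g : ℝ → ℝ} {ε τ τ₁ τ₂ c x d : ℝ} {l₁ l₂ : List (ℝ × ℝ)}
    (h₁ : Fam g ε τ₁ c x l₁) (h₂ : Fam g ε τ₂ x d l₂) (hcx : c ≤ x) (hxd : x ≤ d)
    (ht₁ : τ ≤ τ₁) (ht₂ : τ ≤ τ₂) : Fam g ε τ c d (l₁ ++ l₂) := by
  constructor
  · intro p hp
    rcases List.mem_append.1 hp with hp | hp
    · obtain ⟨a, b, e, f, h⟩ := h₁.1 p hp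
      exact ⟨a, b, e.trans hxd, f, ht₁.trans h⟩
    · obtain ⟨a, b, e, f, h⟩ := h₂.1 p hp
      exact ⟨hcx.trans a, b, e, f, ht₂.trans h⟩
  · rw [List.pairwise_append]
    refine ⟨h₁.2, h₂.2, ?_⟩
    intro p hp q hq
    exact (h₁.1 p hp).2.2.1.trans (h₂.1 q hq).1

lemma tot_append (l₁ l₂ : List (ℝ × ℝ)) : tot (l₁ ++ l₂) = tot l₁ + tot l₂ := by
  simp [tot]

lemma Fam.nil (g : ℝ → ℝ) (ε τ c d : ℝ) : Fam g ε τ c d [] := by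
  simp [Fam]

lemma Fam.single {g : ℝ → ℝ} {ε τ c d : ℝ} (hcd : c < d) (h : GoodIv g ε c d)
    (ht : τ ≤ d - c) : Fam g ε τ c d [(c, d)] := by
  constructor
  · intro p hp
    simp only [List.mem_singleton] at hp
    subst hp
    exact ⟨le_rfl, hcd, le_rfl, h, ht⟩
  · simp

/-- an interval which, if long, is good, gives a family missing at most `δ`. -/
lemma Fam.ofLong {g : ℝ → ℝ} {ε τ c d : ℝ} (hτ : 0 < τ)
    (h : τ ≤ d - c → GoodIv g ε c d) :
    ∃ l, Fam g ε τ c d l ∧ (d - c) - tot l ≤ τ := by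
  by_cases hd : τ ≤ d - c
  · exact ⟨[(c, d)], Fam.single (by linarith) (h hd) hd, by simp [tot]; linarith⟩
  · exact ⟨[], Fam.nil _ _ _ _ _, by simp [tot]; linarith⟩

lemma interp_mem {c d A B x : ℝ} (hcd : c < d) (hAB : B ≤ A) (hx : x ∈ Set.Icc c d) :
    B ≤ A + (B - A) / (d - c) * (x - c) ∧ A + (B - A) / (d - c) * (x - c) ≤ A := by
  have hdc : 0 < d - c := by linarith
  have h0 : 0 ≤ (x - c) / (d - c) := div_nonneg (by linarith [hx.1]) hdc.le
  have h1 : (x - c) / (d - c) ≤ 1 := by rw [div_le_one hdc]; linarith [hx.2]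
  have e : (B - A) / (d - c) * (x - c) = (B - A) * ((x - c) / (d - c)) := by ring
  rw [e]
  constructor <;> nlinarith

/-- Case A: `g` drops little between two contact points. -/
lemma leafA {g : ℝ → ℝ} {ε c d : ℝ} (hε : 0 < ε) (hcd : c < d)
    (hg : ContinuousOn g (Set.Icc c d)) (hmin : ∀ x ∈ Set.Icc c d, g d ≤ g x)
    (hdrop : g c - g d ≤ ε ^ 2 * (d - c)) :
    ∃ l, Fam g ε (ε * (d - c)) c d l ∧ (d - c) - tot l ≤ 2 * ε * (d - c) := by
  have hgdc : g d ≤ g c := hmin c ⟨le_rfl, hcd.le⟩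
  have hS : IsCompact (Set.Icc c d ∩ g ⁻¹' Set.Ici (g c)) :=
    IsCompact.of_isClosed_subset isCompact_Icc
      (hg.preimage_isClosed_of_isClosed isClosed_Icc isClosed_Ici) Set.inter_subset_left
  obtain ⟨x, hx⟩ := hS.exists_isGreatest ⟨c, ⟨⟨le_rfl, hcd.le⟩, (le_rfl : g c ≤ g c)⟩⟩
  have hxI : x ∈ Set.Icc c d := hx.1.1
  have hxg : g c ≤ g x := hx.1.2
  have hafter : ∀ z ∈ Set.Icc x d, z ≠ x → g z < g c := by
    intro z hz hne
    by_contra hcon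
    have : z ≤ x := hx.2 ⟨⟨hxI.1.trans hz.1, hz.2⟩, not_lt.1 hcon⟩
    exact hne (le_antisymm this hz.1)
  have hxeq : g x = g c := by
    obtain ⟨z, hz, hzg⟩ := intermediate_value_Icc' hxI.2
      (hg.mono (Set.Icc_subset_Icc_left hxI.1)) ⟨hgdc, hxg⟩
    by_cases hzx : z = x
    · rw [← hzx, hzg]
    · exact absurd hzg (hafter z hz hzx).ne
  have hdc : 0 < d - c := by linarith
  have hτ : 0 < ε * (d - c) := mul_pos hε hdc
  obtain ⟨l₁, hl₁, ht₁⟩ := Fam.ofLong (g := g) (ε := ε) (c := c) (d := x) hτ (by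
    intro hlong
    right
    refine ⟨?_, hxeq⟩
    intro y hy
    have h1 := hmin y ⟨hy.1, hy.2.trans hxI.2⟩
    have : ε * (ε * (d - c)) ≤ ε * (x - c) := mul_le_mul_of_nonneg_left hlong hε.le
    nlinarith)
  obtain ⟨l₂, hl₂, ht₂⟩ := Fam.ofLong (g := g) (ε := ε) (c := x) (d := d) hτ (by
    intro hlong
    have hxd : x < d := by linarith
    left
    refine ⟨?_, by linarith⟩
    intro y hy
    have h1 := hmin y ⟨hxI.1.trans hy.1, hy.2⟩
    have h2 : g y ≤ g c := by
      by_cases hyx : y = x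
      · rw [hyx, hxeq]
      · exact (hafter y hy hyx).le
    have h3 := interp_mem (A := g x) (B := g d) hxd (by linarith) hy
    have : ε * (ε * (d - c)) ≤ ε * (d - x) := mul_le_mul_of_nonneg_left hlong hε.le
    rw [abs_le]
    constructor <;> nlinarith [h3.1, h3.2])
  refine ⟨l₁ ++ l₂, hl₁.append hl₂ hxI.1 hxI.2 le_rfl le_rfl, ?_⟩
  rw [tot_append]; linarith

/-- Every point lies between two contact points at the same level. -/
lemma bracket {g : ℝ → ℝ} {c d y : ℝ} (hc0 : 0 ≤ c) 
    (hg : ContinuousOn g (Set.Icc c d)) (hc : Contact g c) (hd : Contact g d)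
    (hy : y ∈ Set.Icc c d) :
    ∃ a b, a ∈ Set.Icc c y ∧ b ∈ Set.Icc y d ∧ Contact g a ∧ Contact g b ∧ g a = g b := by
  obtain ⟨a, ha, hamin⟩ := isCompact_Icc.exists_isMinOn (Set.nonempty_Icc.2 hy.1)
    (hg.mono (Set.Icc_subset_Icc_right hy.2))
  have hamin' : ∀ z ∈ Set.Icc c y, g a ≤ g z := fun z hz => hamin hz
  have hall : ∀ z ∈ Set.Icc 0 y, g a ≤ g z := by
    intro z hz
    by_cases hzc : z ≤ c
    · exact (hamin' c ⟨le_rfl, hy.1⟩).trans (hc z ⟨hz.1, hzc⟩)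
    · exact hamin' z ⟨(not_le.1 hzc).le, hz.2⟩
  have haC : Contact g a := fun z hz => hall z ⟨hz.1, hz.2.trans ha.2⟩
  have hgy : ContinuousOn g (Set.Icc y d) := hg.mono (Set.Icc_subset_Icc_left hy.1)
  have hda : g d ≤ g a := hd a ⟨hc0.trans ha.1, ha.2.trans hy.2⟩
  have hS : IsCompact (Set.Icc y d ∩ g ⁻¹' Set.Iic (g a)) :=
    IsCompact.of_isClosed_subset isCompact_Icc
      (hgy.preimage_isClosed_of_isClosed isClosed_Icc isClosed_Iic) Set.inter_subset_left
  obtain ⟨b, hb⟩ := hS.exists_isLeast ⟨d, ⟨⟨hy.2, le_rfl⟩, hda⟩⟩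
  have hbI : b ∈ Set.Icc y d := hb.1.1
  have hbg : g b ≤ g a := hb.1.2
  have hbe : g a = g b := by
    obtain ⟨z, hz, hzg⟩ := intermediate_value_Icc' hbI.1
      (hgy.mono (Set.Icc_subset_Icc_right hbI.2)) ⟨hbg, hall y ⟨hc0.trans hy.1, le_rfl⟩⟩
    have h1 : b ≤ z := hb.2 ⟨⟨hz.1, hz.2.trans hbI.2⟩, hzg.le⟩
    have : z = b := le_antisymm hz.2 h1
    rw [← this, hzg]
  refine ⟨a, b, ha, hbI, haC, ?_, hbe⟩
  intro z hz
  by_cases hzy : z ≤ y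
  · exact hbg.trans (hall z ⟨hz.1, hzy⟩)
  · by_contra hcon
    have h1 : b ≤ z := hb.2 ⟨⟨(not_le.1 hzy).le, hz.2.trans hbI.2⟩, by
      show g z ≤ g a
      linarith [not_le.1 hcon]⟩
    have : z = b := le_antisymm hz.2 h1
    rw [this] at hcon
    exact hcon le_rfl

lemma leaf {g : ℝ → ℝ} {ε m c d : ℝ} (hε : 0 < ε) (hε1 : ε ≤ 1) (hc0 : 0 ≤ c) (hcd : c < d)
    (hdm : d ≤ m) (hL : ∀ x ∈ Set.Icc 0 m, ∀ y ∈ Set.Icc 0 m, |g x - g y| ≤ 4 * |x - y|)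
    (hg : ContinuousOn g (Set.Icc 0 m)) (hc : Contact g c) (hd : Contact g d)
    (hlin : ∀ x ∈ Set.Icc c d, Contact g x →
      |g x - (g c + (g d - g c) / (d - c) * (x - c))| ≤ ε ^ 3 / 17 * (d - c)) :
    ∃ l, Fam g ε (ε * (d - c)) c d l ∧ (d - c) - tot l ≤ 2 * ε * (d - c) := by
  have hdc : 0 < d - c := by linarith
  have hgcd : ContinuousOn g (Set.Icc c d) := hg.mono (Set.Icc_subset_Icc hc0 hdm)
  have hgdc : g d ≤ g c := hd c ⟨hc0, hcd.le⟩
  by_cases hdrop : g c - g d ≤ ε ^ 2 * (d - c)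
  · exact leafA hε hcd hgcd (fun x hx => hd x ⟨hc0.trans hx.1, hx.2⟩) hdrop
  · refine ⟨[(c, d)], Fam.single hcd (Or.inl ⟨?_, hgdc⟩) (by nlinarith), by
      simp [tot]; positivity⟩
    intro y hy
    obtain ⟨a, b, ha, hb, haC, hbC, hab⟩ := bracket hc0 hgcd hc hd hy
    have haI : a ∈ Set.Icc c d := ⟨ha.1, ha.2.trans hy.2⟩
    have hbI : b ∈ Set.Icc c d := ⟨hy.1.trans hb.1, hb.2⟩
    have h1 := abs_le.1 (hlin a haI haC)
    have h2 := abs_le.1 (hlin b hbI hbC)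
    have hcd4 := hL d ⟨by linarith, hdm⟩ c ⟨hc0, by linarith⟩
    rw [abs_of_pos hdc] at hcd4
    have h3 := abs_le.1 (hL y ⟨hc0.trans hy.1, hy.2.trans hdm⟩ a ⟨hc0.trans ha.1, haI.2.trans hdm⟩)
    rw [abs_of_nonneg (by linarith [ha.2] : 0 ≤ y - a)] at h3
    set p := (g d - g c) / (d - c) with hp
    have hp1 : p < -ε ^ 2 := by rw [hp, div_lt_iff₀ hdc]; linarith
    have hp2 : -4 ≤ p := by rw [hp, le_div_iff₀ hdc]; linarith [(abs_le.1 hcd4).1]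
    have hlen : ε ^ 2 * (b - a) ≤ 2 * (ε ^ 3 / 17 * (d - c)) := by
      have : 0 ≤ b - a := by linarith [ha.2, hb.1]
      nlinarith [h1.1, h1.2, h2.1, h2.2]
    have hlen2 : b - a ≤ 2 * (ε / 17 * (d - c)) := by
      have h0 : 0 < ε ^ 2 := by positivity
      refine le_of_mul_le_mul_left (hlen.trans (le_of_eq ?_)) h0
      ring
    have hya : 0 ≤ y - a := by linarith [ha.2]
    have hyb : y - a ≤ b - a := by linarith [hb.1]
    have hp3 : p ≤ 0 := by nlinarith [sq_nonneg ε]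
    have e1 : -4 * (y - a) ≤ p * (y - a) := mul_le_mul_of_nonneg_right hp2 hya
    have e2 : p * (y - a) ≤ 0 := mul_nonpos_of_nonpos_of_nonneg hp3 hya
    have e3 : ε ^ 3 / 17 * (d - c) ≤ ε / 17 * (d - c) := by
      have : ε ^ 3 ≤ ε := by nlinarith [mul_nonneg hε.le (sub_nonneg.2 hε1)]
      nlinarith
    have e4 : p * (y - c) = p * (y - a) + p * (a - c) := by ring
    have e5 : 0 < ε / 17 * (d - c) := by positivity
    rw [abs_le, e4]
    constructor <;> nlinarith [h1.1, h1.2, h3.1, h3.2]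

lemma energy_id {A B u v : ℝ} (hu : 0 < u) (hv : 0 < v) :
    A ^ 2 / u + B ^ 2 / v
      = (A + B) ^ 2 / (u + v) + ((A * v - B * u) / (u + v)) ^ 2 * (u + v) / (u * v) := by
  have : 0 < u + v := by positivity
  field_simp
  ring

lemma split_id {A B u v : ℝ} (hu : 0 < u) (hv : 0 < v) :
    A - (A + B) / (u + v) * u = (A * v - B * u) / (u + v) := by
  have : 0 < u + v := by positivity
  field_simp
  ring

set_option maxHeartbeats 1000000 in
lemma main_rec {g : ℝ → ℝ} {ε m : ℝ} (hε : 0 < ε) (hε1 : ε ≤ 1)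
    (hL : ∀ x ∈ Set.Icc 0 m, ∀ y ∈ Set.Icc 0 m, |g x - g y| ≤ 4 * |x - y|)
    (hg : ContinuousOn g (Set.Icc 0 m)) (k : ℕ) :
    ∀ c d, 0 ≤ c → c < d → d ≤ m → Contact g c → Contact g d →
    ∃ l U, Fam g ε (ε * (ε ^ 3 / 17 / 8) ^ k * (d - c)) c d l ∧
      (d - c) - tot l ≤ U + 2 * ε * (d - c) ∧ U ≤ d - c ∧
      k * (4 * (ε ^ 3 / 17) ^ 2) * U ≤ 16 * (d - c) - (g d - g c) ^ 2 / (d - c) := by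
  have hr0 : 0 < ε ^ 3 / 17 := by positivity
  have hr1 : ε ^ 3 / 17 / 8 ≤ 1 := by
    have : ε ^ 3 ≤ 1 := pow_le_one₀ hε.le hε1
    linarith
  have hE : ∀ c d, 0 ≤ c → c < d → d ≤ m →
      0 ≤ 16 * (d - c) - (g d - g c) ^ 2 / (d - c) := by
    intro c d hc0 hcd hdm
    have hdc : 0 < d - c := by linarith
    have h := hL d ⟨by linarith, hdm⟩ c ⟨hc0, by linarith⟩
    rw [abs_of_pos hdc] at h
    rw [sub_nonneg, div_le_iff₀ hdc]
    have := abs_le.1 h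
    nlinarith [this.1, this.2]
  induction k with
  | zero =>
    intro c d hc0 hcd hdm hc hd
    refine ⟨[], d - c, Fam.nil _ _ _ _ _, ?_, le_rfl, ?_⟩
    · have : 0 < 2 * ε * (d - c) := mul_pos (by positivity) (by linarith)
      simp [tot]; linarith
    · have := hE c d hc0 hcd hdm
      simpa using this
  | succ k ih =>
    intro c d hc0 hcd hdm hc hd
    have hdc : 0 < d - c := by linarith
    by_cases hlin : ∀ x ∈ Set.Icc c d, Contact g x →
      |g x - (g c + (g d - g c) / (d - c) * (x - c))| ≤ ε ^ 3 / 17 * (d - c)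
    · obtain ⟨l, hl, ht⟩ := leaf hε hε1 hc0 hcd hdm hL hg hc hd hlin
      refine ⟨l, 0, ⟨?_, hl.2⟩, by linarith, hdc.le, ?_⟩
      · intro p hp
        obtain ⟨h1, h2, h3, h4, h5⟩ := hl.1 p hp
        refine ⟨h1, h2, h3, h4, le_trans ?_ h5⟩
        have : (ε ^ 3 / 17 / 8) ^ (k + 1) ≤ 1 := pow_le_one₀ (by positivity) hr1
        have h6 : 0 < ε * (d - c) := mul_pos hε hdc
        nlinarith
      · have := hE c d hc0 hcd hdm
        simpa using this
    · push Not at hlin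
      obtain ⟨x, hx, hxC, hdev⟩ := hlin
      have hcx : c < x := by
        rcases hx.1.eq_or_lt with h | h
        · exfalso
          rw [← h] at hdev
          simp at hdev
          nlinarith
        · exact h
      have hxd : x < d := by
        rcases hx.2.eq_or_lt with h | h
        · exfalso
          rw [h, div_mul_cancel₀ _ hdc.ne'] at hdev
          simp at hdev
          nlinarith
        · exact h
      obtain ⟨l₁, U₁, hl₁, ht₁, hU₁, hk₁⟩ := ih c x hc0 hcx (by linarith) hc hxC
      obtain ⟨l₂, U₂, hl₂, ht₂, hU₂, hk₂⟩ := ih x d (by linarith) hxd hdm hxC hd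
      have hu : 0 < x - c := by linarith
      have hv : 0 < d - x := by linarith
      have hA := hL x ⟨by linarith, by linarith⟩ c ⟨hc0, by linarith⟩
      have hB := hL d ⟨by linarith, by linarith⟩ x ⟨by linarith, by linarith⟩
      rw [abs_of_pos hu] at hA
      rw [abs_of_pos hv] at hB
      have hA' := abs_le.1 hA
      have hB' := abs_le.1 hB
      generalize hr : ε ^ 3 / 17 = r at *
      have hsplit : g x - (g c + (g d - g c) / (d - c) * (x - c)) =
          ((g x - g c) * (d - x) - (g d - g x) * (x - c)) / (d - c) := by
        have := split_id (A := g x - g c) (B := g d - g x) hu hv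
        rw [show x - c + (d - x) = d - c by ring,
          show g x - g c + (g d - g x) = g d - g c by ring] at this
        rw [← this]; ring
      rw [hsplit] at hdev
      set D := ((g x - g c) * (d - x) - (g d - g x) * (x - c)) / (d - c) with hD
      have hDD : D * (d - c) = (g x - g c) * (d - x) - (g d - g x) * (x - c) := by
        rw [hD, div_mul_cancel₀ _ hdc.ne']
      have hDb : |D| * (d - c) ≤ 8 * ((x - c) * (d - x)) := by
        rw [← abs_of_pos hdc, ← abs_mul, hDD, abs_le]
        constructor <;> nlinarith [mul_pos hu hv]
      have hDr : r * (d - c) * (d - c) ≤ 8 * ((x - c) * (d - x)) :=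
        le_trans (mul_le_mul_of_nonneg_right hdev.le hdc.le) hDb
      have hs1 : r / 8 * (d - c) ≤ x - c := by
        refine le_of_mul_le_mul_right ?_ hdc
        nlinarith [mul_pos hu hu]
      have hs2 : r / 8 * (d - c) ≤ d - x := by
        refine le_of_mul_le_mul_right ?_ hdc
        nlinarith [mul_pos hv hv]
      have henergy : (g x - g c) ^ 2 / (x - c) + (g d - g x) ^ 2 / (d - x)
          = (g d - g c) ^ 2 / (d - c) + D ^ 2 * (d - c) / ((x - c) * (d - x)) := by
        have := energy_id (A := g x - g c) (B := g d - g x) hu hv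
        rw [show x - c + (d - x) = d - c by ring,
          show g x - g c + (g d - g x) = g d - g c by ring] at this
        exact this
      have hgain : 4 * r ^ 2 * (d - c) ≤ D ^ 2 * (d - c) / ((x - c) * (d - x)) := by
        rw [le_div_iff₀ (mul_pos hu hv)]
        have h1 : (r * (d - c)) ^ 2 ≤ D ^ 2 := by
          rw [← sq_abs D]
          exact pow_le_pow_left₀ (by positivity) hdev.le 2
        have h2 : 4 * ((x - c) * (d - x)) ≤ (d - c) ^ 2 := by nlinarith [sq_nonneg ((x - c) - (d - x))]
        calc 4 * r ^ 2 * (d - c) * ((x - c) * (d - x))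
            = r ^ 2 * (d - c) * (4 * ((x - c) * (d - x))) := by ring
          _ ≤ r ^ 2 * (d - c) * (d - c) ^ 2 := mul_le_mul_of_nonneg_left h2 (by positivity)
          _ = (r * (d - c)) ^ 2 * (d - c) := by ring
          _ ≤ D ^ 2 * (d - c) := mul_le_mul_of_nonneg_right h1 hdc.le
      have hpk : 0 < ε * (r / 8) ^ k := by positivity
      refine ⟨l₁ ++ l₂, U₁ + U₂, hl₁.append hl₂ hcx.le hxd.le ?_ ?_, ?_, by linarith, ?_⟩
      · have := mul_le_mul_of_nonneg_left hs1 hpk.le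
        calc _ = ε * (r / 8) ^ k * (r / 8 * (d - c)) := by ring
          _ ≤ _ := this
      · have := mul_le_mul_of_nonneg_left hs2 hpk.le
        calc _ = ε * (r / 8) ^ k * (r / 8 * (d - c)) := by ring
          _ ≤ _ := this
      · rw [tot_append]; nlinarith
      · push_cast
        have h4 : 4 * r ^ 2 * (U₁ + U₂) ≤ 4 * r ^ 2 * (d - c) :=
          mul_le_mul_of_nonneg_left (by linarith) (by positivity)
        nlinarith

lemma tot_eq_sum (l : List (ℝ × ℝ)) :
    tot l = ∑ j ∈ Finset.range l.length, ((l.getD j (0, 0)).2 - (l.getD j (0, 0)).1) := by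
  unfold tot
  induction l with
  | nil => simp
  | cons a l ih =>
    rw [List.length_cons, Finset.sum_range_succ']
    simp only [List.map_cons, List.sum_cons, ih, List.getD_cons_succ, List.getD_cons_zero]
    ring

/-- dual decomposition lemma: fix `s ∈ (0,1)`, `t ∈ (0,2−s)`.
For every `ε > 0` there is `τ > 0` such that every piecewise affine 2-Lipschitz
`f : [0,m] → ℝ` with `f(0)=0`, `f(x) ≥ tx − εm` and `f(m) ≤ (t+ε)m` admits
non-overlapping intervals `[c_j,d_j] ⊆ [0,m]` with: each either `ε`-linear of slope
`≤ 2−s`, or `ε`-superlinear of slope `= 2−s`; each of length `≥ τm`; and uncovered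
length `≲_{s,t} εm`. -/
theorem stmt15 (s t : ℝ) (hs0 : 0 < s) (hs1 : s < 1) (ht0 : 0 < t) (ht2 : t < 2 - s) :
    ∃ K : ℝ, 0 < K ∧
    ∀ ε : ℝ, 0 < ε → ∃ τ : ℝ, 0 < τ ∧
    ∀ (m : ℝ) (f : ℝ → ℝ), 0 < m →
      PiecewiseAffineOn f 0 m →
      (∀ x ∈ Set.Icc (0:ℝ) m, ∀ y ∈ Set.Icc (0:ℝ) m, |f x - f y| ≤ 2 * |x - y|) →
      f 0 = 0 →
      (∀ x ∈ Set.Icc (0:ℝ) m, t * x - ε * m ≤ f x) →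
      f m ≤ (t + ε) * m →
      ∃ (n : ℕ) (c e : ℕ → ℝ),
        (∀ j < n, 0 ≤ c j ∧ c j < e j ∧ e j ≤ m) ∧
        (∀ i < n, ∀ j < n, i ≠ j → e i ≤ c j ∨ e j ≤ c i) ∧
        (∀ j < n,
          ((∀ x ∈ Set.Icc (c j) (e j),
              |f x - (f (c j) + (f (e j) - f (c j)) / (e j - c j) * (x - c j))| ≤
                ε * (e j - c j)) ∧
            (f (e j) - f (c j)) / (e j - c j) ≤ 2 - s) ∨
          ((∀ x ∈ Set.Icc (c j) (e j),
              f (c j) + (f (e j) - f (c j)) / (e j - c j) * (x - c j) -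
                  ε * (e j - c j) ≤ f x) ∧
            (f (e j) - f (c j)) / (e j - c j) = 2 - s)) ∧
        (∀ j < n, τ * m ≤ e j - c j) ∧
        (m - ∑ j ∈ Finset.range n, (e j - c j) ≤ K * ε * m) := by
  have hσ : 0 < 2 - s - t := by linarith
  refine ⟨2 / (2 - s - t) + 4, by positivity, ?_⟩
  intro ε hε
  obtain ⟨k, hk⟩ := exists_nat_ge (16 / (4 * (ε ^ 3 / 17) ^ 2 * ε))
  refine ⟨ε * (ε ^ 3 / 17 / 8) ^ k * ε, by positivity, ?_⟩
  intro m f hm _ hLip hf0 hlow hfm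
  by_cases hKε : 1 ≤ (2 / (2 - s - t) + 4) * ε
  · refine ⟨0, fun _ => 0, fun _ => 0, by simp, by simp, by simp, by simp, ?_⟩
    simp
    nlinarith
  push Not at hKε
  have hq : 0 < 2 / (2 - s - t) := by positivity
  have hε1 : ε ≤ 1 := by nlinarith [mul_pos hq hε]
  set g : ℝ → ℝ := fun x => f x - (2 - s) * x with hgdef
  have hL : ∀ x ∈ Set.Icc 0 m, ∀ y ∈ Set.Icc 0 m, |g x - g y| ≤ 4 * |x - y| := by
    intro x hx y hy
    have h1 := hLip x hx y hy
    have h2 : g x - g y = (f x - f y) - (2 - s) * (x - y) := by simp only [hgdef]; ring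
    have h3 : |(2 - s) * (x - y)| ≤ 2 * |x - y| := by
      rw [abs_mul, abs_of_pos (by linarith : 0 < 2 - s)]
      nlinarith [abs_nonneg (x - y)]
    rw [h2]
    have := abs_sub (f x - f y) ((2 - s) * (x - y))
    linarith
  have hg : ContinuousOn g (Set.Icc 0 m) := by
    have : LipschitzOnWith 4 g (Set.Icc 0 m) := by
      apply LipschitzOnWith.of_dist_le_mul
      intro x hx y hy
      simpa [Real.dist_eq] using hL x hx y hy
    exact this.continuousOn
  obtain ⟨d, hd, hdmin⟩ := isCompact_Icc.exists_isMinOn (Set.nonempty_Icc.2 hm.le) hg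
  have hdmin' : ∀ z ∈ Set.Icc 0 m, g d ≤ g z := fun z hz => hdmin hz
  have hdC : Contact g d := fun z hz => hdmin' z ⟨hz.1, hz.2.trans hd.2⟩
  have h0C : Contact g 0 := by
    intro z hz
    have : z = 0 := le_antisymm hz.2 hz.1
    rw [this]
  have hmd : m - d ≤ 2 / (2 - s - t) * ε * m := by
    have h1 := hdmin' m ⟨hm.le, le_rfl⟩
    have h2 := hlow d hd
    simp only [hgdef] at h1
    have h3 : (m - d) * (2 - s - t) ≤ 2 * ε * m := by nlinarith
    calc m - d ≤ 2 * ε * m / (2 - s - t) := by rw [le_div_iff₀ hσ]; exact h3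
      _ = _ := by ring
  have hdε : ε * m ≤ d := by nlinarith [mul_pos hε hm]
  have hd0 : 0 < d := lt_of_lt_of_le (mul_pos hε hm) hdε
  obtain ⟨l, U, hl, ht, -, hU⟩ := main_rec hε hε1 hL hg k 0 d le_rfl hd0 hd.2 h0C hdC
  have hUb : U ≤ ε * d := by
    by_contra hcon
    push Not at hcon
    have hU' : k * (4 * (ε ^ 3 / 17) ^ 2) * U ≤ 16 * d := by
      have : 0 ≤ (g d - g 0) ^ 2 / (d - 0) := by rw [sub_zero]; positivity
      linarith
    rw [div_le_iff₀ (by positivity)] at hk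
    have hr : 0 < 4 * (ε ^ 3 / 17) ^ 2 := by positivity
    have hUpos : 0 < U := lt_trans (mul_pos hε hd0) hcon
    have hkpos : 0 < (k : ℝ) * (4 * (ε ^ 3 / 17) ^ 2) := by
      by_contra hneg
      push Not at hneg
      nlinarith
    have h1 := mul_lt_mul_of_pos_left hcon hkpos
    have h2 := mul_le_mul_of_nonneg_right hk hd0.le
    nlinarith
  have hget : ∀ j < l.length, l.getD j (0, 0) ∈ l := by
    intro j hj
    rw [List.getD_eq_getElem _ _ hj]
    exact List.getElem_mem hj
  have hord : ∀ i j, i < j → j < l.length → (l.getD i (0, 0)).2 ≤ (l.getD j (0, 0)).1 := by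
    intro i j hij hj
    rw [List.getD_eq_getElem _ _ hj, List.getD_eq_getElem _ _ (hij.trans hj)]
    exact List.pairwise_iff_getElem.1 hl.2 i j (hij.trans hj) hj hij
  refine ⟨l.length, fun j => (l.getD j (0, 0)).1, fun j => (l.getD j (0, 0)).2, ?_, ?_, ?_, ?_, ?_⟩
  · intro j hj
    obtain ⟨h1, h2, h3, -, -⟩ := hl.1 _ (hget j hj)
    exact ⟨h1, h2, h3.trans hd.2⟩
  · intro i hi j hj hij
    rcases lt_or_gt_of_ne hij with h | h
    · exact Or.inl (hord i j h hj)
    · exact Or.inr (hord j i h hi)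
  · intro j hj
    obtain ⟨-, h2, -, hG, -⟩ := hl.1 _ (hget j hj)
    dsimp only
    generalize (l.getD j (0, 0)).1 = a at *
    generalize (l.getD j (0, 0)).2 = b at *
    have hab : 0 < b - a := by linarith
    have hsl : (f b - f a) / (b - a) = (g b - g a) / (b - a) + (2 - s) := by
      simp only [hgdef]; field_simp; ring
    have hfg : ∀ x, f x = g x + (2 - s) * x := by intro x; simp only [hgdef]; ring
    rcases hG with ⟨hlin, hle⟩ | ⟨hsup, heq⟩
    · left
      refine ⟨?_, ?_⟩
      · intro x hx
        rw [hsl, hfg x, hfg a]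
        convert hlin x hx using 2
        ring
      · rw [hsl]
        have : (g b - g a) / (b - a) ≤ 0 := div_nonpos_of_nonpos_of_nonneg (by linarith) hab.le
        linarith
    · right
      have h0 : (g b - g a) / (b - a) = 0 := by rw [heq]; simp
      refine ⟨?_, ?_⟩
      · intro x hx
        rw [hsl, h0, hfg x, hfg a]
        have := hsup x hx
        linarith
      · rw [hsl, h0]; ring
  · intro j hj
    obtain ⟨-, -, -, -, h5⟩ := hl.1 _ (hget j hj)
    refine le_trans ?_ h5
    have hpk : 0 < ε * (ε ^ 3 / 17 / 8) ^ k := by positivity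
    have := mul_le_mul_of_nonneg_left hdε hpk.le
    rw [sub_zero]
    linarith
  · rw [← tot_eq_sum]
    have : ε * d ≤ ε * m := mul_le_mul_of_nonneg_left hd.2 hε.le
    nlinarith [mul_pos hε hm]
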